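/- Let 𝛂 = (α₁,…,α_m) and 𝛃 = (β₁,…,β_n) be finite tuples of multiplicative characters of κ. Then for every λ ∈ κ: [∏_{i=1}^m (−g(α_i)) / ∏_{j=1}^n (−q⁻¹·g°(β_j))] · F(𝛂, 𝛃; λ) = −∑ ∏_{i=1}^m ψ(s_i)α_i(s_i) · ∏_{j=1}^n ψ(−t_j)β̄_j(t_j), where the sum on the right runs over all (s₁,…,s_m, t₁,…,t_n) ∈ κ^{m+n} with λ·s₁⋯s_m = t₁⋯t_n. -/

import Mathlib

/-!
Finite-field hypergeometric functions (Otsubo), basic definitions: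
`κ` is a finite field with `q = Fintype.card κ` elements, `ψ` a fixed nontrivial
additive character, multiplicative characters are `MulChar κ ℂ` (extended by `0`
on `0`, with trivial character `1`).
-/

open scoped Classical

noncomputable section

variable {κ : Type*} [Field κ] [Fintype κ]

instance : Fintype (MulChar κ ℂ) := Fintype.ofFinite _

/-- The Gauss sum `g(φ) = -∑_{x ∈ κ} ψ(x) φ(x)`. -/
def gS (ψ : AddChar κ ℂ) (φ : MulChar κ ℂ) : ℂ := -∑ x : κ, ψ x * φ x

/-- The variant `g°(φ) = q^{δ(φ)} · g(φ)`, where `δ(φ) = 1` iff `φ` is trivial. -/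
def gSo (ψ : AddChar κ ℂ) (φ : MulChar κ ℂ) : ℂ :=
  (if φ = 1 then (Fintype.card κ : ℂ) else 1) * gS ψ φ

/-- The Pochhammer symbol `(α)_ν = g(αν)/g(α)`. -/
def poch (ψ : AddChar κ ℂ) (α ν : MulChar κ ℂ) : ℂ := gS ψ (α * ν) / gS ψ α

/-- The variant Pochhammer symbol `(α)°_ν = g°(αν)/g°(α)`. -/
def pocho (ψ : AddChar κ ℂ) (α ν : MulChar κ ℂ) : ℂ := gSo ψ (α * ν) / gSo ψ α

/-- The finite hypergeometric function for tuples `𝛂`, `𝛃` of multiplicative characters: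
`F(𝛂,𝛃;λ) = (1/(1-q)) ∑_ν (∏ᵢ (αᵢ)_ν / ∏ⱼ (βⱼ)°_ν) ν(λ)`. -/
def FhT (ψ : AddChar κ ℂ) {m n : ℕ} (A : Fin m → MulChar κ ℂ) (B : Fin n → MulChar κ ℂ)
    (l : κ) : ℂ :=
  (1 - (Fintype.card κ : ℂ))⁻¹ *
    ∑ ν : MulChar κ ℂ, ((∏ i, poch ψ (A i) ν) / ∏ j, pocho ψ (B j) ν) * ν l

lemma gS_eq_neg_gaussSum (ψ : AddChar κ ℂ) (χ : MulChar κ ℂ) : gS ψ χ = -gaussSum χ ψ := by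
  simp only [gS, gaussSum, mul_comm]

lemma gS_one {ψ : AddChar κ ℂ} (hψ : ψ ≠ 1) : gS ψ 1 = 1 := by
  rw [gS_eq_neg_gaussSum, gaussSum_one_left hψ, neg_neg]

lemma gS_ne_zero {ψ : AddChar κ ℂ} (hψ : ψ ≠ 1) (χ : MulChar κ ℂ) : gS ψ χ ≠ 0 := by
  rcases eq_or_ne χ 1 with rfl | hχ
  · simp [gS_one hψ]
  · rw [gS_eq_neg_gaussSum]
    exact neg_ne_zero.mpr (gaussSum_ne_zero_of_nontrivial
      (Nat.cast_ne_zero.mpr Fintype.card_ne_zero) hχ (AddChar.IsPrimitive.of_ne_one hψ))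

lemma gSo_ne_zero {ψ : AddChar κ ℂ} (hψ : ψ ≠ 1) (χ : MulChar κ ℂ) : gSo ψ χ ≠ 0 := by
  refine mul_ne_zero ?_ (gS_ne_zero hψ χ)
  split_ifs
  · exact Nat.cast_ne_zero.mpr Fintype.card_ne_zero
  · exact one_ne_zero

/-- The reflection formula for Gauss sums, uniform in `χ` thanks to the variant `gSo`. -/
lemma sum_neg_mul_inv_eq_inv_gSo {ψ : AddChar κ ℂ} (hψ : ψ ≠ 1) (χ : MulChar κ ℂ) :
    ∑ t : κ, ψ (-t) * χ⁻¹ t = (-((Fintype.card κ : ℂ)⁻¹ * gSo ψ χ))⁻¹ := by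
  have hq : (Fintype.card κ : ℂ) ≠ 0 := Nat.cast_ne_zero.mpr Fintype.card_ne_zero
  have hsum : ∑ t : κ, ψ (-t) * χ⁻¹ t = gaussSum χ⁻¹ ψ⁻¹ := by
    simp only [gaussSum, AddChar.inv_apply, mul_comm]
  rw [hsum]
  rcases eq_or_ne χ 1 with rfl | hχ
  · rw [inv_one, gaussSum_one_left (inv_ne_one.mpr hψ), gSo, if_pos rfl, gS_one hψ, mul_one,
      inv_mul_cancel₀ hq, inv_neg, inv_one]
  · have h := gaussSum_mul_gaussSum_eq_card hχ (AddChar.IsPrimitive.of_ne_one hψ)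
    rw [gSo, if_neg hχ, one_mul, gS_eq_neg_gaussSum, mul_neg, neg_neg]
    refine eq_inv_of_mul_eq_one_left ?_
    rw [mul_comm, mul_assoc, h, inv_mul_cancel₀ hq]

lemma sum_mulChar_apply (a : κ) :
    ∑ χ : MulChar κ ℂ, χ a = if a = 1 then (Fintype.card κ : ℂ) - 1 else 0 := by
  split_ifs with ha
  · have hcard : Fintype.card (MulChar κ ℂ) = Fintype.card κ - 1 := by
      rw [← Nat.card_eq_fintype_card, MulChar.card_eq_card_units_of_hasEnoughRootsOfUnity,
        Nat.card_eq_fintype_card, Fintype.card_units]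
    simp [ha, hcard, Nat.cast_sub (Fintype.card_pos (α := κ))]
  · obtain ⟨χ, hχ⟩ := MulChar.exists_apply_ne_one_of_hasEnoughRootsOfUnity κ ℂ ha
    refine eq_zero_of_mul_eq_self_left hχ ?_
    simp only [Finset.mul_sum, ← MulChar.mul_apply]
    exact Fintype.sum_bijective _ (Group.mulLeft_bijective χ) _ _ fun _ ↦ rfl

lemma sum_mulChar_mul_inv_apply (a : κ) {b : κ} (hb : b ≠ 0) :
    ∑ χ : MulChar κ ℂ, χ a * χ⁻¹ b = if a = b then (Fintype.card κ : ℂ) - 1 else 0 := by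
  simp only [MulChar.inv_apply', ← map_mul, sum_mulChar_apply, ← div_eq_mul_inv,
    div_eq_one_iff_eq hb]

/-- The summand of `FhT`, normalised by Gauss sums, as a product of one-variable sums. -/
lemma gS_quotient_mul_poch_quotient {ψ : AddChar κ ℂ} (hψ : ψ ≠ 1) {m n : ℕ}
    (A : Fin m → MulChar κ ℂ) (B : Fin n → MulChar κ ℂ) (ν : MulChar κ ℂ) :
    ((∏ i, -gS ψ (A i)) / ∏ j, (-((Fintype.card κ : ℂ)⁻¹ * gSo ψ (B j)))) *
        ((∏ i, poch ψ (A i) ν) / ∏ j, pocho ψ (B j) ν) =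
      (∏ i, ∑ s : κ, ψ s * (A i * ν) s) * ∏ j, ∑ t : κ, ψ (-t) * (B j * ν)⁻¹ t := by
  rw [div_mul_div_comm, ← Finset.prod_mul_distrib, ← Finset.prod_mul_distrib, div_eq_mul_inv,
    ← Finset.prod_inv_distrib]
  congr 1
  · refine Finset.prod_congr rfl fun i _ ↦ ?_
    rw [poch, neg_mul, mul_div_cancel₀ _ (gS_ne_zero hψ _), gS, neg_neg]
  · refine Finset.prod_congr rfl fun j _ ↦ ?_
    rw [sum_neg_mul_inv_eq_inv_gSo hψ, pocho, neg_mul, mul_assoc,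
      mul_div_cancel₀ _ (gSo_ne_zero hψ _)]

/-- Expansion of a product of twisted one-variable sums. -/
lemma prod_sum_twist (ψ : AddChar κ ℂ) {m n : ℕ}
    (A : Fin m → MulChar κ ℂ) (B : Fin n → MulChar κ ℂ) (ν : MulChar κ ℂ) :
    (∏ i, ∑ s : κ, ψ s * (A i * ν) s) * ∏ j, ∑ t : κ, ψ (-t) * (B j * ν)⁻¹ t =
      ∑ p : (Fin m → κ) × (Fin n → κ),
        ((∏ i, ψ (p.1 i) * A i (p.1 i)) * ∏ j, ψ (-(p.2 j)) * (B j)⁻¹ (p.2 j)) *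
          (ν (∏ i, p.1 i) * ν⁻¹ (∏ j, p.2 j)) := by
  rw [Fintype.prod_sum, Fintype.prod_sum, Finset.sum_mul_sum, Fintype.sum_prod_type]
  refine Finset.sum_congr rfl fun s _ ↦ Finset.sum_congr rfl fun t _ ↦ ?_
  simp only [mul_inv, MulChar.mul_apply, map_prod, ← mul_assoc, Finset.prod_mul_distrib]
  ring

/-- Kloosterman-sum representation: for all tuples `𝛂`, `𝛃` and `λ ∈ κ`,
`(∏ᵢ(-g(αᵢ)) / ∏ⱼ(-q⁻¹ g°(βⱼ))) F(𝛂,𝛃;λ)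
  = -∑_{λ s₁⋯s_m = t₁⋯t_n} ∏ᵢ ψ(sᵢ)αᵢ(sᵢ) ∏ⱼ ψ(-tⱼ)β̄ⱼ(tⱼ)`. -/
theorem stmt_7 (ψ : AddChar κ ℂ) (hψ : ψ ≠ 1) {m n : ℕ}
    (A : Fin m → MulChar κ ℂ) (B : Fin n → MulChar κ ℂ) (l : κ) :
    ((∏ i, -gS ψ (A i)) / ∏ j, (-((Fintype.card κ : ℂ)⁻¹ * gSo ψ (B j)))) *
        FhT ψ A B l =
      -∑ p ∈ Finset.univ.filter
          (fun p : (Fin m → κ) × (Fin n → κ) => l * ∏ i, p.1 i = ∏ j, p.2 j),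
          (∏ i, ψ (p.1 i) * A i (p.1 i)) * ∏ j, ψ (-(p.2 j)) * (B j)⁻¹ (p.2 j) := by
  have hq : (Fintype.card κ : ℂ) - 1 ≠ 0 :=
    sub_ne_zero.mpr (Nat.cast_ne_one.mpr Fintype.one_lt_card.ne')
  have hq' : (1 - (Fintype.card κ : ℂ))⁻¹ * ((Fintype.card κ : ℂ) - 1) = -1 := by
    rw [← neg_sub, inv_neg, neg_mul, inv_mul_cancel₀ hq]
  rw [FhT, mul_left_comm, Finset.mul_sum]
  simp only [← mul_assoc (_ / _) (_ / _), gS_quotient_mul_poch_quotient hψ, prod_sum_twist,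
    Finset.sum_mul]
  rw [Finset.sum_comm, Finset.mul_sum, Finset.sum_filter, ← Finset.sum_neg_distrib]
  refine Finset.sum_congr rfl fun p _ ↦ ?_
  by_cases ht : ∏ j, p.2 j = 0
  · obtain ⟨j, -, hj⟩ := Finset.prod_eq_zero_iff.mp ht
    have hz : ∏ j, ψ (-(p.2 j)) * (B j)⁻¹ (p.2 j) = 0 :=
      Finset.prod_eq_zero (Finset.mem_univ j) (by rw [hj, MulChar.map_zero, mul_zero])
    simp [hz]
  · simp only [mul_assoc _ _ (_ : ℂ), ← Finset.mul_sum]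
    have hν : ∑ ν : MulChar κ ℂ, ν (∏ i, p.1 i) * (ν⁻¹ (∏ j, p.2 j) * ν l) =
        if l * ∏ i, p.1 i = ∏ j, p.2 j then (Fintype.card κ : ℂ) - 1 else 0 := by
      rw [← sum_mulChar_mul_inv_apply _ ht]
      refine Finset.sum_congr rfl fun ν _ ↦ ?_
      rw [map_mul]
      ring
    rw [hν]
    split_ifs
    · linear_combination
        ((∏ i, ψ (p.1 i) * A i (p.1 i)) * ∏ j, ψ (-(p.2 j)) * (B j)⁻¹ (p.2 j)) * hq'
    · simp

end
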